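/- arXiv:2008.03038 — 4 statements merged into one kernel-verified Lean document; each statement's English description precedes it below -/
import Mathlib

section
/- Let d ≥ 1 be an integer and let 0 ≤ a < d/2. Then ∬_{{‖u‖ ≤ 1} × {‖v‖ ≤ 1}} ‖u‖^{-a} ‖v‖^{-a} ‖u - v‖^{-a} du dv < ∞. (This is the finiteness of the integral J* in the paper's proof of the expected triangle count Theorem, with a = γ² and 2γ² < d, i.e., fractality parameter ν < 1/2.) -/
open MeasureTheory Real

/-- Young's inequality for two negative powers of nonnegative reals. -/
lemma rpow_neg_mul_rpow_neg_le {s t a : ℝ} (hs : 0 ≤ s) (ht : 0 ≤ t) :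
    s ^ (-a) * t ^ (-a) ≤ s ^ (-(2 * a)) + t ^ (-(2 * a)) := by
  have key : ∀ x : ℝ, 0 ≤ x → x ^ (-(2 * a)) = (x ^ (-a)) ^ 2 := fun x hx => by
    rw [← rpow_mul_natCast hx]
    congr 1
    push_cast
    ring
  rw [key s hs, key t ht]
  nlinarith [sq_nonneg (s ^ (-a) - t ^ (-a)), sq_nonneg (s ^ (-a)), sq_nonneg (t ^ (-a))]

/-- For `0 ≤ a < d/2`,
`∬_{‖u‖≤1, ‖v‖≤1} ‖u‖^{-a} ‖v‖^{-a} ‖u-v‖^{-a} du dv < ∞`. -/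
theorem integrable_triple_riesz_on_balls
    (d : ℕ) (hd : 1 ≤ d) (a : ℝ) (ha : 0 ≤ a) (had : a < d / 2) :
    IntegrableOn (fun p : EuclideanSpace ℝ (Fin d) × EuclideanSpace ℝ (Fin d) =>
        ‖p.1‖ ^ (-a) * ‖p.2‖ ^ (-a) * ‖p.1 - p.2‖ ^ (-a))
      (Metric.closedBall 0 1 ×ˢ Metric.closedBall 0 1) := by
  have hball (b : ℝ) (hb : b < d) : Integrable ((Metric.ball 0 3).indicator
      (fun x : EuclideanSpace ℝ (Fin d) => ‖x‖ ^ (-b))) :=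
    (integrableOn_ball_of_norm_le_rpow (C := 1) (α := b) (by simpa using hd) (by simpa using hb)
      (.of_forall fun x => by rw [norm_of_nonneg (by positivity), one_mul])
      (Measurable.aestronglyMeasurable (by fun_prop))).integrable_indicator measurableSet_ball
  have hG := hball (2 * a) (by linarith)
  have hH := hball a (by linarith)
  have hbound := (hG.mul_prod hH).add
    (hH.convolution_integrand (ContinuousLinearMap.mul ℝ ℝ) hG)
  refine Integrable.mono' hbound.integrableOn
    (Measurable.aestronglyMeasurable (by fun_prop)) ?_
  refine ae_restrict_of_forall_mem (measurableSet_closedBall.prod measurableSet_closedBall) ?_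
  rintro ⟨u, v⟩ ⟨hu, hv⟩
  simp only [mem_closedBall_zero_iff] at hu hv
  have hu3 : u ∈ Metric.ball 0 3 := by rw [mem_ball_zero_iff]; linarith
  have hv3 : v ∈ Metric.ball 0 3 := by rw [mem_ball_zero_iff]; linarith
  have huv3 : u - v ∈ Metric.ball 0 3 := by
    rw [mem_ball_zero_iff]; linarith [norm_sub_le u v]
  rw [norm_of_nonneg (by positivity)]
  simp only [Pi.add_apply, ContinuousLinearMap.mul_apply', Set.indicator_of_mem hu3,
    Set.indicator_of_mem hv3, Set.indicator_of_mem huv3]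
  have hle := mul_le_mul_of_nonneg_right
    (rpow_neg_mul_rpow_neg_le (a := a) (norm_nonneg u) (norm_nonneg (u - v)))
    (rpow_nonneg (norm_nonneg v) (-a))
  linarith
end

section
/- Let d ≥ 1 be an integer and 0 ≤ a < d. Then sup_{v ∈ ℝ^d} ∫_{{u : ‖u‖ > 1}} ‖u - v‖^{-a} ‖u‖^{-a} e^{-‖u‖² - ‖u-v‖²} du < ∞; that is, the integral is finite and uniformly bounded in v. -/
open MeasureTheory Real

/-- A radial power `‖w‖^s` with `s > -dim E`, times a Gaussian, is integrable. -/
theorem integrable_norm_rpow_mul_exp_neg_sq {E : Type*} [NormedAddCommGroup E] [NormedSpace ℝ E]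
    [FiniteDimensional ℝ E] [Nontrivial E] [MeasurableSpace E] [BorelSpace E]
    (μ : Measure E) [μ.IsAddHaarMeasure] {s : ℝ} (hs : -(Module.finrank ℝ E : ℝ) < s) :
    Integrable (fun w : E => ‖w‖ ^ s * Real.exp (-‖w‖ ^ 2)) μ := by
  rw [integrable_fun_norm_addHaar μ (f := fun r : ℝ => r ^ s * Real.exp (-r ^ 2))]
  have hpos : 1 ≤ Module.finrank ℝ E := Module.finrank_pos
  have h := integrableOn_rpow_mul_exp_neg_mul_sq one_pos
    (s := ((Module.finrank ℝ E - 1 : ℕ) : ℝ) + s) (by push_cast [hpos]; linarith)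
  refine h.congr_fun (fun r hr => ?_) measurableSet_Ioi
  simp only [smul_eq_mul, Real.rpow_add hr, Real.rpow_natCast, neg_mul, one_mul, mul_assoc]

/-- For `0 ≤ a < d`, the integral `∫_{‖u‖>1} ‖u-v‖^{-a} ‖u‖^{-a} e^{-‖u‖²-‖u-v‖²} du`
is finite, uniformly bounded in `v ∈ ℝ^d`. -/
theorem uniform_bound_outside_ball
    (d : ℕ) (hd : 1 ≤ d) (a : ℝ) (ha : 0 ≤ a) (had : a < d) :
    ∃ B : ℝ, ∀ v : EuclideanSpace ℝ (Fin d),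
      ∫⁻ u in {u : EuclideanSpace ℝ (Fin d) | 1 < ‖u‖},
          ENNReal.ofReal
            (‖u - v‖ ^ (-a) * ‖u‖ ^ (-a) * Real.exp (-‖u‖ ^ 2 - ‖u - v‖ ^ 2))
        ≤ ENNReal.ofReal B := by
  have : Nonempty (Fin d) := ⟨⟨0, hd⟩⟩
  have hint := integrable_norm_rpow_mul_exp_neg_sq
    (volume : Measure (EuclideanSpace ℝ (Fin d))) (s := -a) (by simpa using had)
  refine ⟨∫ w : EuclideanSpace ℝ (Fin d), ‖w‖ ^ (-a) * Real.exp (-‖w‖ ^ 2), fun v => ?_⟩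
  rw [ofReal_integral_eq_lintegral_ofReal hint (ae_of_all _ fun w => by positivity),
    ← lintegral_sub_right_eq_self (μ := volume)
      (fun w : EuclideanSpace ℝ (Fin d) =>
        ENNReal.ofReal (‖w‖ ^ (-a) * Real.exp (-‖w‖ ^ 2))) v]
  refine (setLIntegral_mono' (measurableSet_lt measurable_const measurable_norm)
    fun u hu => ENNReal.ofReal_le_ofReal ?_).trans (setLIntegral_le_lintegral _ _)
  have hu1 : ‖u‖ ^ (-a) ≤ 1 :=
    Real.rpow_le_one_of_one_le_of_nonpos (le_of_lt hu) (neg_nonpos.2 ha)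
  have hexp : Real.exp (-‖u‖ ^ 2 - ‖u - v‖ ^ 2) ≤ Real.exp (-‖u - v‖ ^ 2) :=
    Real.exp_le_exp.2 (by linarith [sq_nonneg ‖u‖])
  exact mul_le_mul (mul_le_of_le_one_right (Real.rpow_nonneg (norm_nonneg _) _) hu1) hexp (by positivity)
    (by positivity)
end

section
/- Let d ≥ 1 and k ≥ 2 be integers and let a ≥ 0 satisfy k a < d and k(k-1)a/2 < d. Then K := ∫_{(ℝ^d)^k} exp(-Σ_{i=1}^k ‖x_i‖²) · (∏_{1 ≤ i < j ≤ k} ‖x_i - x_j‖^{-a}) · (∏_{i=1}^k ‖x_i‖^{-a}) dx_1 ⋯ dx_k < ∞. (This is the finiteness of the constant K in the paper's expected hub-and-spoke count Theorem: for ν = γ²/d < min(1/k, 2/(k(k-1))) and a = γ², the expected number of k-spokes satisfies E[S_k] = C(γ,d,k,ρ) n^{1+ν}(1+o(1)).) -/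
open MeasureTheory Real Finset

theorem Finset.prod_le_one_add_sum_pow {ι : Type*} (s : Finset ι) (u : ι → ℝ)
    (hu : ∀ i ∈ s, 0 ≤ u i) {k : ℕ} (hk : #s ≤ k) :
    ∏ i ∈ s, u i ≤ 1 + ∑ i ∈ s, u i ^ k := by
  have hsum : 0 ≤ ∑ i ∈ s, u i ^ k := sum_nonneg fun i hi => pow_nonneg (hu i hi) k
  by_cases h : ∀ i ∈ s, u i ≤ 1
  · linarith [prod_le_one hu h]
  · push Not at h
    obtain ⟨i, hi, hui⟩ := h
    obtain ⟨m, hm, hmax⟩ := exists_max_image s u ⟨i, hi⟩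
    have hum : 1 ≤ u m := hui.le.trans (hmax i hi)
    calc ∏ i ∈ s, u i ≤ ∏ _i ∈ s, u m := prod_le_prod hu hmax
      _ = u m ^ #s := by simp
      _ ≤ u m ^ k := pow_le_pow_right₀ hum hk
      _ ≤ ∑ i ∈ s, u i ^ k :=
        single_le_sum (f := fun i => u i ^ k) (fun i hi => pow_nonneg (hu i hi) k) hm
      _ ≤ 1 + ∑ i ∈ s, u i ^ k := by linarith

section Gaussian

variable {E : Type*} [NormedAddCommGroup E] [InnerProductSpace ℝ E] [FiniteDimensional ℝ E]
  [MeasurableSpace E] [BorelSpace E]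

theorem integrable_exp_neg_norm_sq : Integrable (fun x : E => Real.exp (-‖x‖ ^ 2)) := by
  have h := (GaussianFourier.integrable_cexp_neg_mul_sq_norm_add (V := E) (b := 1)
    (by simp) 0 0).norm
  refine h.congr (Filter.Eventually.of_forall fun x => ?_)
  simp [Complex.norm_exp, ← Complex.ofReal_pow]

/-- A Gaussian integrates `‖x - y‖ ^ (-b)`, `b < dim E`, with a bound that is uniform in `y`. -/
theorem exists_lintegral_exp_neg_norm_sq_mul_rpow_le (hd : 1 ≤ Module.finrank ℝ E) {b : ℝ}
    (hb : 0 ≤ b) (hbd : b < Module.finrank ℝ E) :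
    ∃ C : ENNReal, C < ⊤ ∧ ∀ y : E,
      ∫⁻ x : E, ENNReal.ofReal (Real.exp (-‖x‖ ^ 2) * ‖x - y‖ ^ (-b)) ≤ C := by
  have hball : IntegrableOn (fun x : E => ‖x‖ ^ (-b)) (Metric.ball 0 1) := by
    refine integrableOn_ball_of_norm_le_rpow (C := 1) hd hbd
      (Filter.Eventually.of_forall fun x => ?_) (Measurable.aestronglyMeasurable (by fun_prop))
    rw [Real.norm_of_nonneg (by positivity), one_mul]
  set g : E → ENNReal :=
    (Metric.ball (0 : E) 1).indicator fun x => ENNReal.ofReal (‖x‖ ^ (-b)) with hg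
  have hgm : Measurable g := Measurable.indicator (by fun_prop) measurableSet_ball
  refine ⟨(∫⁻ x, g x) + ∫⁻ x : E, ENNReal.ofReal (Real.exp (-‖x‖ ^ 2)), ?_, fun y => ?_⟩
  · refine ENNReal.add_lt_top.2 ⟨?_, integrable_exp_neg_norm_sq.lintegral_lt_top⟩
    rw [hg, lintegral_indicator measurableSet_ball]
    exact Integrable.lintegral_lt_top hball
  · rw [← lintegral_sub_right_eq_self g y, ← lintegral_add_left (by fun_prop)]
    refine lintegral_mono fun x => ?_
    by_cases hx : x - y ∈ Metric.ball (0 : E) 1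
    · rw [hg, Set.indicator_of_mem hx]
      refine le_add_right (ENNReal.ofReal_le_ofReal ?_)
      exact mul_le_of_le_one_left (by positivity) (Real.exp_le_one_iff.2 (by simp))
    · refine le_add_left (ENNReal.ofReal_le_ofReal ?_)
      rw [mem_ball_zero_iff, not_lt] at hx
      exact mul_le_of_le_one_right (by positivity)
        (Real.rpow_le_one_of_one_le_of_nonpos hx (by linarith))

theorem exists_lintegral_exp_neg_norm_sq_mul_prod_rpow_le (hd : 1 ≤ Module.finrank ℝ E)
    {a : ℝ} (ha : 0 ≤ a) {k : ℕ} (hk : (k : ℝ) * a < Module.finrank ℝ E) {m : ℕ} (hm : m ≤ k) :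
    ∃ C : ENNReal, C < ⊤ ∧ ∀ z : Fin m → E,
      ∫⁻ x : E, ENNReal.ofReal (Real.exp (-‖x‖ ^ 2) * ∏ i, ‖x - z i‖ ^ (-a)) ≤ C := by
  obtain ⟨C, hC, hCz⟩ := exists_lintegral_exp_neg_norm_sq_mul_rpow_le (E := E) hd
    (b := k * a) (by positivity) hk
  refine ⟨(∫⁻ x : E, ENNReal.ofReal (Real.exp (-‖x‖ ^ 2))) + m * C,
    ENNReal.add_lt_top.2 ⟨integrable_exp_neg_norm_sq.lintegral_lt_top,
      ENNReal.mul_lt_top (by simp) hC⟩, fun z => ?_⟩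
  calc ∫⁻ x : E, ENNReal.ofReal (Real.exp (-‖x‖ ^ 2) * ∏ i, ‖x - z i‖ ^ (-a))
    _ ≤ ∫⁻ x : E, (ENNReal.ofReal (Real.exp (-‖x‖ ^ 2)) +
          ∑ i, ENNReal.ofReal (Real.exp (-‖x‖ ^ 2) * ‖x - z i‖ ^ (-(k * a)))) := by
        refine lintegral_mono fun x => ?_
        rw [← ENNReal.ofReal_sum_of_nonneg fun i _ => by positivity,
          ← ENNReal.ofReal_add (by positivity) (sum_nonneg fun i _ => by positivity)]
        refine ENNReal.ofReal_le_ofReal ?_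
        rw [← mul_sum, ← mul_one_add]
        refine mul_le_mul_of_nonneg_left ?_ (by positivity)
        refine (prod_le_one_add_sum_pow univ _ (fun i _ => by positivity)
          (by simpa using hm)).trans_eq ?_
        congr 1
        refine sum_congr rfl fun i _ => ?_
        rw [← Real.rpow_mul_natCast (norm_nonneg _)]
        congr 1
        ring
    _ = (∫⁻ x : E, ENNReal.ofReal (Real.exp (-‖x‖ ^ 2))) +
          ∑ i, ∫⁻ x : E, ENNReal.ofReal (Real.exp (-‖x‖ ^ 2) * ‖x - z i‖ ^ (-(k * a))) := by
        rw [lintegral_add_left (by fun_prop), lintegral_finsetSum _ fun i _ => by fun_prop]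
    _ ≤ _ := by
        gcongr
        exact (sum_le_card_nsmul _ _ C fun i _ => hCz (z i)).trans_eq (by simp)

theorem lintegral_spoke_lt_top (hd : 1 ≤ Module.finrank ℝ E)
    {a : ℝ} (ha : 0 ≤ a) {k : ℕ} (hk : (k : ℝ) * a < Module.finrank ℝ E) {n : ℕ} (hn : n ≤ k) :
    ∫⁻ x : Fin n → E, ENNReal.ofReal (Real.exp (-∑ i, ‖x i‖ ^ 2) *
      (∏ i, ∏ j ∈ Finset.Ioi i, ‖x i - x j‖ ^ (-a)) * ∏ i, ‖x i‖ ^ (-a)) < ⊤ := by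
  induction n with
  | zero => simp [lintegral_unique, volume_pi]
  | succ n ih =>
    obtain ⟨C, hC, hCz⟩ :=
      exists_lintegral_exp_neg_norm_sq_mul_prod_rpow_le (E := E) hd ha hk hn
    set F : (Fin n → E) → ℝ := fun y => Real.exp (-∑ i, ‖y i‖ ^ 2) *
      (∏ i, ∏ j ∈ Finset.Ioi i, ‖y i - y j‖ ^ (-a)) * ∏ i, ‖y i‖ ^ (-a) with hF
    have hFm : Measurable F := by fun_prop
    rw [← ((volume_preserving_piFinSuccAbove (fun _ : Fin (n + 1) => E) 0).symm).lintegral_comp_emb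
      (MeasurableEquiv.measurableEmbedding _)]
    calc _ = ∫⁻ p : E × (Fin n → E), ENNReal.ofReal (Real.exp (-‖p.1‖ ^ 2) *
          ∏ i, ‖p.1 - (Fin.cons 0 p.2 : Fin (n + 1) → E) i‖ ^ (-a)) * ENNReal.ofReal (F p.2) := by
          refine lintegral_congr fun p => ?_
          rw [← ENNReal.ofReal_mul (by positivity)]
          congr 1
          simp only [MeasurableEquiv.piFinSuccAbove_symm_apply, Fin.insertNthEquiv,
            Equiv.coe_fn_mk, Fin.insertNth_zero', Fin.prod_univ_succ, Fin.sum_univ_succ,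
            Fin.cons_zero, Fin.cons_succ, Fin.prod_Ioi_succ, sub_zero, hF,
            Fin.prod_Ioi_zero, neg_add, Real.exp_add]
          ring
      _ = ∫⁻ y : Fin n → E, ∫⁻ x : E, ENNReal.ofReal (Real.exp (-‖x‖ ^ 2) *
          ∏ i, ‖x - (Fin.cons 0 y : Fin (n + 1) → E) i‖ ^ (-a)) * ENNReal.ofReal (F y) := by
          refine lintegral_prod_symm' _ ?_
          simp only [Fin.prod_univ_succ, Fin.cons_zero, Fin.cons_succ]
          fun_prop
      _ ≤ ∫⁻ y : Fin n → E, C * ENNReal.ofReal (F y) := by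
          refine lintegral_mono fun y => ?_
          rw [lintegral_mul_const _ (by fun_prop)]
          gcongr
          exact hCz _
      _ = C * ∫⁻ y : Fin n → E, ENNReal.ofReal (F y) := lintegral_const_mul _ (by fun_prop)
      _ < ⊤ := ENNReal.mul_lt_top hC (ih (by omega))

end Gaussian

/-- Finiteness of the hub-and-spoke constant: for `k ≥ 2` and `a ≥ 0` with `ka < d` and
`k(k-1)a/2 < d`,
`K = ∫_{(ℝ^d)^k} e^{-Σᵢ‖xᵢ‖²} ∏_{i<j} ‖xᵢ-xⱼ‖^{-a} ∏ᵢ ‖xᵢ‖^{-a} dx < ∞`. -/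
theorem hub_spoke_constant_finite
    (d k : ℕ) (hd : 1 ≤ d) (hk : 2 ≤ k) (a : ℝ) (ha : 0 ≤ a)
    (h1 : (k : ℝ) * a < d) (h2 : (k : ℝ) * ((k : ℝ) - 1) * a / 2 < d) :
    Integrable (fun x : Fin k → EuclideanSpace ℝ (Fin d) =>
      Real.exp (-∑ i, ‖x i‖ ^ 2) *
        (∏ i, ∏ j ∈ Finset.Ioi i, ‖x i - x j‖ ^ (-a)) *
        ∏ i, ‖x i‖ ^ (-a)) := by
  refine ⟨by fun_prop, ?_⟩
  rw [hasFiniteIntegral_iff_ofReal (Filter.Eventually.of_forall fun x => by positivity)]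
  exact lintegral_spoke_lt_top (by simpa using hd) ha (by simpa using h1) le_rfl
end

section
/- Let d ≥ 1 and k ≥ 2 be integers and let a ≥ 0 satisfy k a < d and k(k-1)a/2 < d. Then K' := ∫_{(ℝ^d)^k} exp(-Σ_{1 ≤ i < j ≤ k} ‖x_i - x_j‖² - Σ_{i=1}^k ‖x_i‖²) · (∏_{1 ≤ i < j ≤ k} ‖x_i - x_j‖^{-a}) · (∏_{i=1}^k ‖x_i‖^{-a}) dx_1 ⋯ dx_k < ∞. (This is the finiteness of the constant K' in the paper's expected k-clique count Theorem: for cliques on k+1 vertices with ν = γ²/d < min(1/k, 2/(k(k-1))) and a = γ², the expected (k+1)-clique count satisfies E[Q_{k+1}] = C(γ,d,k,ρ) n^{1+ν}(1+o(1)); K' ≤ K since the clique integrand carries the extra factor exp(-Σ_{i<j} ‖x_i - x_j‖²) ≤ 1.) -/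
open MeasureTheory Real Finset
open scoped ENNReal

section InnerProductSpace

variable {V : Type*} [NormedAddCommGroup V] [InnerProductSpace ℝ V] [FiniteDimensional ℝ V]
  [MeasurableSpace V] [BorelSpace V]

lemma integrable_exp_neg_sq_norm : Integrable fun v : V => Real.exp (-‖v‖ ^ 2) := by
  have h := (GaussianFourier.integrable_cexp_neg_mul_sq_norm_add (V := V) (b := 1)
    (by simp) 0 0).re
  refine h.congr (.of_forall fun v => ?_)
  have : Complex.exp (-1 * (‖v‖ : ℂ) ^ 2 + 0 * inner ℝ (0 : V) v)
      = ((Real.exp (-‖v‖ ^ 2) : ℝ) : ℂ) := by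
    push_cast; simp
  exact (congrArg Complex.re this).trans (Complex.ofReal_re _)

/-- `‖v‖ ^ (-b)` is integrable near the origin when `b` is less than the dimension. -/
lemma lintegral_indicator_norm_rpow_neg_lt_top {b : ℝ} (hb : 0 ≤ b)
    (hbd : b < Module.finrank ℝ V) :
    ∫⁻ v : V, ENNReal.ofReal ((Metric.ball 0 1).indicator (fun v => ‖v‖ ^ (-b)) v) < ∞ := by
  have hpos : 0 < Module.finrank ℝ V := by exact_mod_cast hb.trans_lt hbd
  refine Integrable.lintegral_lt_top ((integrable_indicator_iff measurableSet_ball).2 ?_)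
  refine integrableOn_ball_of_norm_le_rpow (C := 1) hpos hbd (.of_forall fun v => ?_)
    (Measurable.aestronglyMeasurable (by fun_prop))
  rw [Real.norm_of_nonneg (by positivity), one_mul]

/-- The Gaussian average of a shifted subcritical power is bounded uniformly in the shift. -/
lemma exists_lintegral_exp_mul_norm_sub_rpow_neg_le {b : ℝ} (hb : 0 ≤ b)
    (hbd : b < Module.finrank ℝ V) :
    ∃ C < ∞, ∀ u : V, ∫⁻ v : V, ENNReal.ofReal (Real.exp (-‖v‖ ^ 2)) *
      ENNReal.ofReal (‖v - u‖ ^ (-b)) ≤ C := by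
  refine ⟨_, ENNReal.add_lt_top.2 ⟨lintegral_indicator_norm_rpow_neg_lt_top hb hbd,
    (integrable_exp_neg_sq_norm (V := V)).lintegral_lt_top⟩, fun u => ?_⟩
  rw [← lintegral_sub_right_eq_self (fun v : V =>
    ENNReal.ofReal ((Metric.ball 0 1).indicator (fun v => ‖v‖ ^ (-b)) v)) u,
    ← lintegral_add_right _ (by fun_prop)]
  refine lintegral_mono fun v => ?_
  by_cases h : ‖v - u‖ < 1
  · rw [Set.indicator_of_mem (show v - u ∈ Metric.ball 0 1 by simpa using h)]
    refine le_add_right (mul_le_of_le_one_left' ?_)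
    simp
  · refine le_add_left (mul_le_of_le_one_right' ?_)
    rw [ENNReal.ofReal_le_one]
    exact Real.rpow_le_one_of_one_le_of_nonpos (not_lt.1 h) (by linarith)

/-- A product is at most the sum of the `n`-th powers of its `n` factors. -/
lemma ENNReal.prod_le_sum_pow_card {ι : Type*} [Fintype ι] [Nonempty ι] (f : ι → ℝ≥0∞) :
    ∏ i, f i ≤ ∑ i, f i ^ Fintype.card ι := by
  obtain ⟨i, hi⟩ := Finite.exists_max f
  calc ∏ j, f j ≤ f i ^ Fintype.card ι := Finset.prod_le_pow_card _ _ _ fun j _ => hi j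
    _ ≤ ∑ j, f j ^ Fintype.card ι :=
      Finset.single_le_sum (f := fun j => f j ^ Fintype.card ι) (fun _ _ => zero_le) (mem_univ i)

lemma exists_lintegral_exp_mul_prod_norm_sub_rpow_neg_le {ι : Type*} [Fintype ι] [Nonempty ι]
    {a : ℝ} (ha : 0 ≤ a) (had : Fintype.card ι * a < Module.finrank ℝ V) :
    ∃ C < ∞, ∀ u : ι → V, ∫⁻ v : V, ENNReal.ofReal (Real.exp (-‖v‖ ^ 2)) *
      ∏ i, ENNReal.ofReal (‖v - u i‖ ^ (-a)) ≤ C := by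
  obtain ⟨C, hC, h⟩ := exists_lintegral_exp_mul_norm_sub_rpow_neg_le (V := V)
    (b := Fintype.card ι * a) (by positivity) had
  refine ⟨Fintype.card ι * C, ENNReal.mul_lt_top (by simp) hC, fun u => ?_⟩
  calc
    _ ≤ ∫⁻ v : V, ∑ i, ENNReal.ofReal (Real.exp (-‖v‖ ^ 2)) *
        ENNReal.ofReal (‖v - u i‖ ^ (-(Fintype.card ι * a))) := by
      refine lintegral_mono fun v => ?_
      rw [← Finset.mul_sum]
      gcongr
      refine (ENNReal.prod_le_sum_pow_card _).trans_eq (Finset.sum_congr rfl fun i _ => ?_)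
      rw [← ENNReal.ofReal_pow (by positivity), ← Real.rpow_mul_natCast (norm_nonneg _)]
      congr 2
      ring
    _ = ∑ i, ∫⁻ v : V, ENNReal.ofReal (Real.exp (-‖v‖ ^ 2)) *
        ENNReal.ofReal (‖v - u i‖ ^ (-(Fintype.card ι * a))) :=
      lintegral_finsetSum _ fun i _ => by fun_prop
    _ ≤ ∑ _i : ι, C := Finset.sum_le_sum fun i _ => h _
    _ = _ := by simp

/-- The pair factors and the one-point factors of the clique integrand have finite integral. -/
lemma lintegral_prod_norm_sub_rpow_neg_lt_top {a : ℝ} (ha : 0 ≤ a) (n : ℕ)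
    (had : n * a < Module.finrank ℝ V) :
    ∫⁻ x : Fin n → V, ∏ i, (ENNReal.ofReal (Real.exp (-‖x i‖ ^ 2)) *
      ((∏ j ∈ Finset.Ioi i, ENNReal.ofReal (‖x i - x j‖ ^ (-a))) *
        ENNReal.ofReal (‖x i‖ ^ (-a)))) < ∞ := by
  induction n with
  | zero => simp [lintegral_const, volume_pi]
  | succ n ih =>
    obtain ⟨C, hC, h⟩ := exists_lintegral_exp_mul_prod_norm_sub_rpow_neg_le (V := V)
      (ι := Fin (n + 1)) ha (by simpa using had)
    have ih := ih (lt_of_le_of_lt (by gcongr; simp) had)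
    rw [← (volume_preserving_piFinSuccAbove (fun _ : Fin (n + 1) => V) 0).symm.lintegral_comp_emb
      (MeasurableEquiv.measurableEmbedding _), Measure.volume_eq_prod,
      lintegral_prod_symm _ (by fun_prop)]
    refine lt_of_le_of_lt (lintegral_mono fun y => ?_)
      ((lintegral_const_mul' C _ hC.ne).trans_lt (ENNReal.mul_lt_top hC ih))
    simp only [Fin.prod_univ_succ, Fin.prod_Ioi_zero, Fin.prod_Ioi_succ]
    simp only [MeasurableEquiv.piFinSuccAbove_symm_apply, Fin.insertNthEquiv_apply,
      Fin.insertNth_zero', Fin.cons_zero, Fin.cons_succ]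
    rw [lintegral_mul_const _ (by fun_prop)]
    gcongr
    refine le_of_eq_of_le (lintegral_congr fun v => ?_) (h (Fin.cons 0 y))
    simp [Fin.prod_univ_succ, mul_comm]

end InnerProductSpace

/-- Finiteness of the clique-count constant: for `k ≥ 2` and `a ≥ 0` with `ka < d` and
`k(k-1)a/2 < d`,
`K' = ∫_{(ℝ^d)^k} e^{-Σ_{i<j}‖xᵢ-xⱼ‖² - Σᵢ‖xᵢ‖²} ∏_{i<j} ‖xᵢ-xⱼ‖^{-a} ∏ᵢ ‖xᵢ‖^{-a} dx < ∞`. -/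
theorem clique_constant_finite
    (d k : ℕ) (hd : 1 ≤ d) (hk : 2 ≤ k) (a : ℝ) (ha : 0 ≤ a)
    (h1 : (k : ℝ) * a < d) (h2 : (k : ℝ) * ((k : ℝ) - 1) * a / 2 < d) :
    Integrable (fun x : Fin k → EuclideanSpace ℝ (Fin d) =>
      Real.exp (-(∑ i, ∑ j ∈ Finset.Ioi i, ‖x i - x j‖ ^ 2) - ∑ i, ‖x i‖ ^ 2) *
        (∏ i, ∏ j ∈ Finset.Ioi i, ‖x i - x j‖ ^ (-a)) *
        ∏ i, ‖x i‖ ^ (-a)) := by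
  have had : (k : ℝ) * a < Module.finrank ℝ (EuclideanSpace ℝ (Fin d)) := by simpa using h1
  refine ⟨Measurable.aestronglyMeasurable (by fun_prop), ?_⟩
  refine lt_of_le_of_lt (lintegral_mono fun x => ?_)
    (lintegral_prod_norm_sub_rpow_neg_lt_top ha k had)
  rw [Real.enorm_of_nonneg (by positivity)]
  simp_rw [← ENNReal.ofReal_prod_of_nonneg (fun j _ => Real.rpow_nonneg (norm_nonneg _) _)]
  simp_rw [Finset.prod_mul_distrib, ← mul_assoc]
  rw [ENNReal.ofReal_mul (by positivity), ENNReal.ofReal_mul (by positivity),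
    ENNReal.ofReal_prod_of_nonneg (f := fun i => ‖x i‖ ^ (-a)) (fun _ _ => by positivity),
    ← ENNReal.ofReal_prod_of_nonneg (f := fun i => Real.exp (-‖x i‖ ^ 2))
      (fun _ _ => by positivity),
    ← ENNReal.ofReal_prod_of_nonneg
      (f := fun i => ∏ j ∈ Finset.Ioi i, ‖x i - x j‖ ^ (-a)) (fun _ _ => by positivity),
    ← Real.exp_sum]
  gcongr
  rw [Finset.sum_neg_distrib]
  have : 0 ≤ ∑ i, ∑ j ∈ Finset.Ioi i, ‖x i - x j‖ ^ 2 := by positivity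
  linarith
end
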